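/- Let Ω ⊆ ℝ^d be a nonempty open set, let H = Σ_{|α|≤m} c_α D^α be an m-th order constant-coefficient operator (m ≥ 1), let V ∈ C^∞(Ω, ℂ), λ ∈ ℂ, and let ψ_λ be a smooth solution of (H + V)ψ_λ = λψ_λ on Ω. Let χ ∈ C_c^∞(ℝ^d) with supp χ ⊆ B(x₀,r) where B(x₀,r) ⊆ Ω. Then for every integer α ≥ 1 there exists a finite family (h_γ)_{γ ∈ ℕ^d, |γ| ≤ α(m−1)} of smooth functions on Ω, each supported in B(x₀,r) (and depending only on χ, V, λ, H, α), such that (H − λ)^α (χ ψ_λ) = Σ_{|γ| ≤ α(m−1)} h_γ · D^γ ψ_λ on Ω. -/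

import Mathlib

open MeasureTheory Metric Complex Finset ENNReal NNReal

noncomputable section

variable {d : ℕ}

/-- Euclidean space ℝ^d. -/
abbrev Euc (d : ℕ) := EuclideanSpace ℝ (Fin d)

/-- Partial derivative in coordinate direction `j`. -/
def pd (j : Fin d) (f : Euc d → ℂ) : Euc d → ℂ :=
  fun x => fderiv ℝ f x (EuclideanSpace.single j 1)

/-- The operator `D^γ = (−i∂₁)^{γ₁} ⋯ (−i∂_d)^{γ_d}`. -/
def Dpow (γ : Fin d → ℕ) (f : Euc d → ℂ) : Euc d → ℂ :=
  fun x => (-Complex.I) ^ (∑ j, γ j) *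
    ((List.finRange d).foldr (fun j g => (pd j)^[γ j] g) f) x

/-- The `L²` norm of `f` on the set `s` (valued in `ℝ≥0∞`). -/
def L2 (f : Euc d → ℂ) (s : Set (Euc d)) : ℝ≥0∞ := eLpNorm f 2 (volume.restrict s)

/-- Euclidean norm of an integer vector `ξ ∈ ℤ^d`. -/
def znorm (ξ : Fin d → ℤ) : ℝ := Real.sqrt (∑ j, ((ξ j : ℝ)) ^ 2)

/-- Embedding of `ℤ^d` into `ℝ^d`. -/
def zcoe (ξ : Fin d → ℤ) : Euc d := (WithLp.equiv 2 (Fin d → ℝ)).symm (fun j => (ξ j : ℝ))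

/-- The symbol `P(ξ)` of a constant coefficient operator, evaluated at real `ξ`. -/
def symbR (P : MvPolynomial (Fin d) ℂ) (ξ : Euc d) : ℂ :=
  MvPolynomial.eval (fun j => (ξ j : ℂ)) P

/-- The symbol `P(ξ)` evaluated at an integer lattice point. -/
def symbZ (P : MvPolynomial (Fin d) ℂ) (ξ : Fin d → ℤ) : ℂ :=
  MvPolynomial.eval (fun j => ((ξ j : ℤ) : ℂ)) P

/-- The constant coefficient differential operator `H = Σ_{α} c_α D^α` with symbol `P`. -/
def toOp (P : MvPolynomial (Fin d) ℂ) (f : Euc d → ℂ) : Euc d → ℂ :=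
  fun x => ∑ α ∈ P.support, P.coeff α * Dpow (fun j => α j) f x

/-- The axis-parallel cube of side length `2π` centered at `x₀`. -/
def cube (x₀ : Euc d) : Set (Euc d) :=
  {y | ∀ j, y j ∈ Set.Icc (x₀ j - Real.pi) (x₀ j + Real.pi)}

/-- The smooth cutoff of `ψ`: `x ↦ χ((x−x₀)/r) ψ(x)`. -/
def cutoffFn (χ : Euc d → ℝ) (x₀ : Euc d) (r : ℝ) (ψ : Euc d → ℂ) : Euc d → ℂ :=
  fun x => (χ (r⁻¹ • (x - x₀)) : ℂ) * ψ x

/-- The `2πℤ^d`-periodization of a function `F : ℝ^d → ℂ`. -/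
def perFn (F : Euc d → ℂ) : Euc d → ℂ :=
  fun x => ∑' k : Fin d → ℤ,
    F (x - (WithLp.equiv 2 (Fin d → ℝ)).symm (fun j => 2 * Real.pi * (k j : ℝ)))

/-- Fourier coefficient (w.r.t. the cube of side `2π` centered at `x₀`):
`Ĝ(ξ) = (2π)^{-d} ∫_{cube} G(x) e^{-i⟨ξ,x⟩} dx`. -/
def fCoeff (x₀ : Euc d) (G : Euc d → ℂ) (ξ : Fin d → ℤ) : ℂ :=
  ((2 * Real.pi) ^ d : ℝ)⁻¹ *
    ∫ x in cube x₀, G x * Complex.exp (-Complex.I * ((∑ j, (ξ j : ℝ) * x j : ℝ) : ℂ))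

/-- The Fourier coefficients `Ψ̂(ξ)` of the periodized cutoff `Ψ` of `ψ`. -/
def PsiHat (χ : Euc d → ℝ) (x₀ : Euc d) (r : ℝ) (ψ : Euc d → ℂ) (ξ : Fin d → ℤ) : ℂ :=
  fCoeff x₀ (perFn (cutoffFn χ x₀ r ψ)) ξ


section helpers

variable {Ω : Set (Euc d)}

/-- Smoothness on `Ω`. -/
def Sm (Ω : Set (Euc d)) (f : Euc d → ℂ) : Prop := ContDiffOn ℝ (⊤ : ℕ∞) f Ω

theorem Sm.diff (hΩ : IsOpen Ω) {f : Euc d → ℂ} (hf : Sm Ω f) {x : Euc d} (hx : x ∈ Ω) :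
    DifferentiableAt ℝ f x :=
  (ContDiffOn.contDiffAt hf (hΩ.mem_nhds hx)).differentiableAt (by simp)

theorem Sm.congr' {f g : Euc d → ℂ} (hf : Sm Ω f) (h : ∀ x ∈ Ω, g x = f x) : Sm Ω g :=
  ContDiffOn.congr hf h

theorem Sm.mul' {f g : Euc d → ℂ} (hf : Sm Ω f) (hg : Sm Ω g) : Sm Ω (fun x => f x * g x) :=
  ContDiffOn.mul hf hg

theorem Sm.add' {f g : Euc d → ℂ} (hf : Sm Ω f) (hg : Sm Ω g) : Sm Ω (fun x => f x + g x) :=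
  ContDiffOn.add hf hg

theorem Sm.const (c : ℂ) : Sm Ω (fun _ => c) := contDiffOn_const

theorem Sm.sum' {ι : Type*} {s : Finset ι} {f : ι → Euc d → ℂ} (hf : ∀ i ∈ s, Sm Ω (f i)) :
    Sm Ω (fun x => ∑ i ∈ s, f i x) := ContDiffOn.sum hf

theorem pd_smooth (hΩ : IsOpen Ω) (j : Fin d) {f : Euc d → ℂ} (hf : Sm Ω f) : Sm Ω (pd j f) := by
  have h : ContDiffOn ℝ (⊤ : ℕ∞) (fderiv ℝ f) Ω :=
    ContDiffOn.fderiv_of_isOpen hf hΩ (by simp)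
  exact ContDiffOn.clm_apply h contDiffOn_const

theorem pd_congr (hΩ : IsOpen Ω) (j : Fin d) {f g : Euc d → ℂ} (h : ∀ x ∈ Ω, f x = g x) :
    ∀ x ∈ Ω, pd j f x = pd j g x := by
  intro x hx
  have : f =ᶠ[nhds x] g := Filter.eventuallyEq_of_mem (hΩ.mem_nhds hx) h
  simp only [pd, this.fderiv_eq]

theorem pd_zero_off {K : Set (Euc d)} (hK : IsClosed K) (j : Fin d) {c : Euc d → ℂ}
    (h : ∀ x ∉ K, c x = 0) : ∀ x ∉ K, pd j c x = 0 := by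
  intro x hx
  rw [pd_congr hK.isOpen_compl j (f := c) (g := fun _ => 0) h x hx]
  simp [pd]

theorem pd_add (hΩ : IsOpen Ω) (j : Fin d) {f g : Euc d → ℂ} (hf : Sm Ω f) (hg : Sm Ω g) :
    ∀ x ∈ Ω, pd j (fun y => f y + g y) x = pd j f x + pd j g x := by
  intro x hx
  simp only [pd]
  rw [fderiv_fun_add (hf.diff hΩ hx) (hg.diff hΩ hx)]
  rfl

theorem pd_mul (hΩ : IsOpen Ω) (j : Fin d) {f g : Euc d → ℂ} (hf : Sm Ω f) (hg : Sm Ω g) :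
    ∀ x ∈ Ω, pd j (fun y => f y * g y) x = pd j f x * g x + f x * pd j g x := by
  intro x hx
  simp only [pd]
  rw [fderiv_fun_mul (hf.diff hΩ hx) (hg.diff hΩ hx)]
  simp
  ring

theorem pd_const_mul (hΩ : IsOpen Ω) (j : Fin d) (c : ℂ) {f : Euc d → ℂ} (hf : Sm Ω f) :
    ∀ x ∈ Ω, pd j (fun y => c * f y) x = c * pd j f x := by
  intro x hx
  rw [pd_mul hΩ j (Sm.const c) hf x hx]
  simp [pd]

theorem pd_comm (hΩ : IsOpen Ω) (i j : Fin d) {f : Euc d → ℂ} (hf : Sm Ω f) :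
    ∀ x ∈ Ω, pd i (pd j f) x = pd j (pd i f) x := by
  intro x hx
  have hc : ContDiffAt ℝ (⊤ : ℕ∞) f x := ContDiffOn.contDiffAt hf (hΩ.mem_nhds hx)
  have hs : IsSymmSndFDerivAt ℝ f x := by
    apply hc.isSymmSndFDerivAt
    simp only [minSmoothness_of_isRCLikeNormedField]
    exact WithTop.coe_le_coe.2 (le_top : (2 : ℕ∞) ≤ ⊤)
  have hd : DifferentiableAt ℝ (fderiv ℝ f) x :=
    (hc.fderiv_right (m := 1) (by norm_cast)).differentiableAt (by simp)
  have key : ∀ v w : Euc d, fderiv ℝ (fun y => fderiv ℝ f y v) x w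
      = fderiv ℝ (fderiv ℝ f) x w v := by
    intro v w
    rw [fderiv_clm_apply hd (differentiableAt_const v)]
    simp
  show fderiv ℝ (fun y => fderiv ℝ f y _) x _ = fderiv ℝ (fun y => fderiv ℝ f y _) x _
  rw [key, key]
  exact hs _ _

theorem pdit_smooth (hΩ : IsOpen Ω) (j : Fin d) (k : ℕ) {f : Euc d → ℂ} (hf : Sm Ω f) :
    Sm Ω ((pd j)^[k] f) := by
  induction k with
  | zero => exact hf
  | succ k ih => rw [Function.iterate_succ_apply']; exact pd_smooth hΩ j ih

theorem pdit_congr (hΩ : IsOpen Ω) (j : Fin d) (k : ℕ) {f g : Euc d → ℂ}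
    (h : ∀ x ∈ Ω, f x = g x) : ∀ x ∈ Ω, (pd j)^[k] f x = (pd j)^[k] g x := by
  induction k with
  | zero => exact h
  | succ k ih => simp only [Function.iterate_succ_apply']; exact pd_congr hΩ j ih

theorem pdit_comm (hΩ : IsOpen Ω) (i j : Fin d) (k : ℕ) {f : Euc d → ℂ} (hf : Sm Ω f) :
    ∀ x ∈ Ω, pd i ((pd j)^[k] f) x = (pd j)^[k] (pd i f) x := by
  induction k with
  | zero => intro x _; rfl
  | succ k ih =>
    intro x hx
    simp only [Function.iterate_succ_apply']
    rw [pd_comm hΩ i j (pdit_smooth hΩ j k hf) x hx]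
    exact pd_congr hΩ j ih x hx

/-- the fold inside `Dpow`. -/
def fo (l : List (Fin d)) (γ : Fin d → ℕ) (f : Euc d → ℂ) : Euc d → ℂ :=
  l.foldr (fun j g => (pd j)^[γ j] g) f

theorem fo_smooth (hΩ : IsOpen Ω) (l : List (Fin d)) (γ : Fin d → ℕ) {f : Euc d → ℂ}
    (hf : Sm Ω f) : Sm Ω (fo l γ f) := by
  induction l with
  | nil => exact hf
  | cons a l ih => exact pdit_smooth hΩ a _ ih

theorem fo_not_mem (l : List (Fin d)) (γ : Fin d → ℕ) (f : Euc d → ℂ) (j : Fin d) (hj : j ∉ l) :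
    fo l (γ + Pi.single j 1) f = fo l γ f := by
  induction l with
  | nil => rfl
  | cons a l ih =>
    simp only [List.mem_cons, not_or] at hj
    have h := ih hj.2
    simp only [fo, List.foldr_cons] at h ⊢
    rw [h]
    simp [Pi.single_eq_of_ne (Ne.symm hj.1)]

theorem fo_mem (hΩ : IsOpen Ω) (l : List (Fin d)) (hl : l.Nodup) (γ : Fin d → ℕ) {f : Euc d → ℂ}
    (hf : Sm Ω f) (j : Fin d) (hj : j ∈ l) :
    ∀ x ∈ Ω, pd j (fo l γ f) x = fo l (γ + Pi.single j 1) f x := by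
  induction l with
  | nil => simp at hj
  | cons a l ih =>
    intro x hx
    rw [List.nodup_cons] at hl
    show pd j ((pd a)^[γ a] (fo l γ f)) x
      = (pd a)^[(γ + Pi.single j 1 : Fin d → ℕ) a] (fo l (γ + Pi.single j 1) f) x
    by_cases h : j = a
    · subst h
      rw [fo_not_mem l γ f j hl.1, ← Function.iterate_succ_apply' (pd j)]
      simp
    · have hjl : j ∈ l := by simpa [h] using hj
      rw [pdit_comm hΩ j a _ (fo_smooth hΩ l γ hf) x hx]
      rw [pdit_congr hΩ a _ (ih hl.2 hjl) x hx]
      simp [Pi.single_eq_of_ne (Ne.symm h)]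

theorem Dpow_zero (f : Euc d → ℂ) : Dpow 0 f = f := by
  have : ∀ l : List (Fin d), fo l 0 f = f := by
    intro l
    induction l with
    | nil => rfl
    | cons a l ih => exact ih
  funext x
  have h := congrFun (this (List.finRange d)) x
  simp only [fo] at h
  simp only [Dpow, h]
  simp

theorem Dpow_smooth (hΩ : IsOpen Ω) (γ : Fin d → ℕ) {f : Euc d → ℂ} (hf : Sm Ω f) :
    Sm Ω (Dpow γ f) := (Sm.const _).mul' (fo_smooth hΩ _ γ hf)

theorem sum_succ (γ : Fin d → ℕ) (j : Fin d) :
    ∑ i, (γ + Pi.single j 1 : Fin d → ℕ) i = (∑ i, γ i) + 1 := by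
  simp [Finset.sum_add_distrib]

theorem Dpow_succ (hΩ : IsOpen Ω) (γ : Fin d → ℕ) (j : Fin d) {f : Euc d → ℂ} (hf : Sm Ω f) :
    ∀ x ∈ Ω, Dpow (γ + Pi.single j 1) f x = -Complex.I * pd j (Dpow γ f) x := by
  intro x hx
  have h1 := pd_const_mul hΩ j ((-Complex.I) ^ (∑ j, γ j))
    (fo_smooth hΩ (List.finRange d) γ hf) x hx
  have h2 := fo_mem hΩ (List.finRange d) (List.nodup_finRange d) γ hf j (List.mem_finRange j) x hx
  have h3 : pd j (Dpow γ f) x = _ := h1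
  rw [h3, h2]
  simp only [Dpow, sum_succ, fo]
  ring

theorem ind_multi {p : (Fin d → ℕ) → Prop} (h0 : p 0)
    (hs : ∀ γ j, p γ → p (γ + Pi.single j 1)) (γ : Fin d → ℕ) : p γ := by
  induction hn : ∑ j, γ j generalizing γ with
  | zero =>
    have : γ = 0 := by
      funext j
      exact (Finset.sum_eq_zero_iff.mp hn) j (Finset.mem_univ j)
    rwa [this]
  | succ n ih =>
    have : ∃ j, γ j ≠ 0 := by
      by_contra! hc
      simp [hc] at hn
    obtain ⟨j, hj⟩ := this
    have e : γ = (γ - Pi.single j 1) + Pi.single j 1 := by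
      funext i
      by_cases h : i = j
      · subst h; simp; omega
      · simp [h]
    rw [e]
    apply hs
    apply ih
    have := sum_succ (γ - Pi.single j 1) j
    rw [← e] at this
    omega

theorem Dpow_congr (hΩ : IsOpen Ω) (γ : Fin d → ℕ) {f g : Euc d → ℂ} (hf : Sm Ω f)
    (hg : Sm Ω g) (h : ∀ x ∈ Ω, f x = g x) : ∀ x ∈ Ω, Dpow γ f x = Dpow γ g x := by
  induction γ using ind_multi with
  | h0 => simpa [Dpow_zero] using h
  | hs γ j ih =>
    intro x hx
    rw [Dpow_succ hΩ γ j hf x hx, Dpow_succ hΩ γ j hg x hx, pd_congr hΩ j ih x hx]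

theorem Dpow_add (hΩ : IsOpen Ω) (γ : Fin d → ℕ) {f g : Euc d → ℂ} (hf : Sm Ω f)
    (hg : Sm Ω g) : ∀ x ∈ Ω, Dpow γ (fun y => f y + g y) x = Dpow γ f x + Dpow γ g x := by
  induction γ using ind_multi with
  | h0 => simp [Dpow_zero]
  | hs γ j ih =>
    intro x hx
    rw [Dpow_succ hΩ γ j hf x hx, Dpow_succ hΩ γ j hg x hx, Dpow_succ hΩ γ j (hf.add' hg) x hx,
      pd_congr hΩ j ih x hx, pd_add hΩ j (Dpow_smooth hΩ γ hf) (Dpow_smooth hΩ γ hg) x hx]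
    ring

theorem Dpow_const_mul (hΩ : IsOpen Ω) (γ : Fin d → ℕ) (c : ℂ) {f : Euc d → ℂ} (hf : Sm Ω f) :
    ∀ x ∈ Ω, Dpow γ (fun y => c * f y) x = c * Dpow γ f x := by
  induction γ using ind_multi with
  | h0 => simp [Dpow_zero]
  | hs γ j ih =>
    intro x hx
    rw [Dpow_succ hΩ γ j hf x hx, Dpow_succ hΩ γ j ((Sm.const c).mul' hf) x hx,
      pd_congr hΩ j ih x hx, pd_const_mul hΩ j c (Dpow_smooth hΩ γ hf) x hx]
    ring

theorem Dpow_sum (hΩ : IsOpen Ω) (γ : Fin d → ℕ) {ι : Type*} (s : Finset ι)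
    {f : ι → Euc d → ℂ} (hf : ∀ i ∈ s, Sm Ω (f i)) :
    ∀ x ∈ Ω, Dpow γ (fun y => ∑ i ∈ s, f i y) x = ∑ i ∈ s, Dpow γ (f i) x := by
  classical
  induction s using Finset.induction_on with
  | empty =>
    intro x hx
    have := Dpow_const_mul hΩ γ 0 (Sm.const (Ω := Ω) 0) x hx
    simpa using this
  | insert a s ha ih =>
    intro x hx
    have hs : ∀ i ∈ s, Sm Ω (f i) := fun i hi => hf i (Finset.mem_insert_of_mem hi)
    simp only [Finset.sum_insert ha]
    rw [Dpow_add hΩ γ (hf a (Finset.mem_insert_self a s)) (Sm.sum' hs) x hx, ih hs x hx]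

theorem Dpow_Dpow (hΩ : IsOpen Ω) (γ δ : Fin d → ℕ) {f : Euc d → ℂ} (hf : Sm Ω f) :
    ∀ x ∈ Ω, Dpow γ (Dpow δ f) x = Dpow (γ + δ) f x := by
  induction γ using ind_multi with
  | h0 => simp [Dpow_zero]
  | hs γ j ih =>
    intro x hx
    have e : γ + Pi.single j 1 + δ = (γ + δ) + Pi.single j 1 := by abel
    rw [e, Dpow_succ hΩ γ j (Dpow_smooth hΩ δ hf) x hx, Dpow_succ hΩ _ j hf x hx,
      pd_congr hΩ j ih x hx]

theorem toOp_smooth (hΩ : IsOpen Ω) (P : MvPolynomial (Fin d) ℂ) {f : Euc d → ℂ} (hf : Sm Ω f) :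
    Sm Ω (toOp P f) := Sm.sum' fun _ _ => (Sm.const _).mul' (Dpow_smooth hΩ _ hf)

theorem toOp_congr (hΩ : IsOpen Ω) (P : MvPolynomial (Fin d) ℂ) {f g : Euc d → ℂ} (hf : Sm Ω f)
    (hg : Sm Ω g) (h : ∀ x ∈ Ω, f x = g x) : ∀ x ∈ Ω, toOp P f x = toOp P g x := by
  intro x hx
  simp only [toOp]
  exact Finset.sum_congr rfl fun β _ => by rw [Dpow_congr hΩ _ hf hg h x hx]

theorem toOp_sum (hΩ : IsOpen Ω) (P : MvPolynomial (Fin d) ℂ) {ι : Type*} (s : Finset ι)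
    {f : ι → Euc d → ℂ} (hf : ∀ i ∈ s, Sm Ω (f i)) :
    ∀ x ∈ Ω, toOp P (fun y => ∑ i ∈ s, f i y) x = ∑ i ∈ s, toOp P (f i) x := by
  intro x hx
  simp only [toOp]
  rw [Finset.sum_comm]
  exact Finset.sum_congr rfl fun β _ => by rw [Dpow_sum hΩ _ s hf x hx, Finset.mul_sum]

theorem toOp_Dpow (hΩ : IsOpen Ω) (P : MvPolynomial (Fin d) ℂ) (γ : Fin d → ℕ)
    {f : Euc d → ℂ} (hf : Sm Ω f) :
    ∀ x ∈ Ω, toOp P (Dpow γ f) x = Dpow γ (toOp P f) x := by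
  intro x hx
  have h : Dpow γ (toOp P f) x = _ := Dpow_sum hΩ γ P.support
    (f := fun β y => P.coeff β * Dpow (fun j => β j) f y)
    (fun _ _ => (Sm.const _).mul' (Dpow_smooth hΩ _ hf)) x hx
  rw [h]
  simp only [toOp]
  refine Finset.sum_congr rfl fun β _ => ?_
  rw [Dpow_const_mul hΩ γ _ (Dpow_smooth hΩ _ hf) x hx, Dpow_Dpow hΩ _ _ hf x hx,
    Dpow_Dpow hΩ _ _ hf x hx, add_comm]

/-- multi-indices with `|γ| < n`. -/
def MI (d n : ℕ) : Finset (Fin d → ℕ) :=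
  (Fintype.piFinset fun _ => Finset.range n).filter (fun γ => ∑ j, γ j < n)

theorem mem_MI {n : ℕ} {γ : Fin d → ℕ} : γ ∈ MI d n ↔ ∑ j, γ j < n := by
  simp only [MI, Finset.mem_filter, Fintype.mem_piFinset, Finset.mem_range, and_iff_right_iff_imp]
  intro h j
  exact lt_of_le_of_lt (Finset.single_le_sum (f := γ) (fun _ _ => Nat.zero_le _)
    (Finset.mem_univ j)) h

/-- `T` is, on `Ω` and on the class `A`, a differential operator of order `< n` with smooth
coefficients vanishing off `K`. -/
def DiffRep (Ω : Set (Euc d)) (A : Set (Euc d → ℂ)) (K : Set (Euc d)) (n : ℕ)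
    (T : (Euc d → ℂ) → Euc d → ℂ) : Prop :=
  ∃ c : (Fin d → ℕ) → Euc d → ℂ, (∀ γ, Sm Ω (c γ) ∧ ∀ x ∉ K, c γ x = 0) ∧
    ∀ ψ ∈ A, ∀ x ∈ Ω, T ψ x = ∑ γ ∈ MI d n, c γ x * Dpow γ ψ x

variable {A : Set (Euc d → ℂ)} {K : Set (Euc d)}

theorem DiffRep.congr' {n : ℕ} {T T' : (Euc d → ℂ) → Euc d → ℂ} (h : DiffRep Ω A K n T)
    (e : ∀ ψ ∈ A, ∀ x ∈ Ω, T' ψ x = T ψ x) : DiffRep Ω A K n T' := by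
  obtain ⟨c, hc, h⟩ := h
  exact ⟨c, hc, fun ψ hψ x hx => (e ψ hψ x hx).trans (h ψ hψ x hx)⟩

theorem DiffRep.zero {n : ℕ} : DiffRep Ω A K n (fun _ _ => 0) :=
  ⟨fun _ _ => 0, fun _ => ⟨Sm.const 0, fun _ _ => rfl⟩, by simp⟩

theorem DiffRep.add {n : ℕ} {T T' : (Euc d → ℂ) → Euc d → ℂ} (h : DiffRep Ω A K n T)
    (h' : DiffRep Ω A K n T') : DiffRep Ω A K n (fun ψ x => T ψ x + T' ψ x) := by
  obtain ⟨c, hc, h⟩ := h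
  obtain ⟨c', hc', h'⟩ := h'
  refine ⟨fun γ x => c γ x + c' γ x, fun γ => ⟨(hc γ).1.add' (hc' γ).1, fun x hx => ?_⟩, ?_⟩
  · simp [(hc γ).2 x hx, (hc' γ).2 x hx]
  · intro ψ hψ x hx
    simp only [h ψ hψ x hx, h' ψ hψ x hx, add_mul, Finset.sum_add_distrib]

theorem DiffRep.sum {n : ℕ} {ι : Type*} (s : Finset ι) {T : ι → (Euc d → ℂ) → Euc d → ℂ}
    (h : ∀ i ∈ s, DiffRep Ω A K n (T i)) : DiffRep Ω A K n (fun ψ x => ∑ i ∈ s, T i ψ x) := by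
  classical
  induction s using Finset.induction_on with
  | empty => simpa using DiffRep.zero
  | insert a s ha ih =>
    simp only [Finset.sum_insert ha]
    exact (h a (Finset.mem_insert_self a s)).add
      (ih fun i hi => h i (Finset.mem_insert_of_mem hi))

theorem DiffRep.mono_single {n : ℕ} {c : Euc d → ℂ} (hc : Sm Ω c) (hcK : ∀ x ∉ K, c x = 0)
    (γ : Fin d → ℕ) (hγ : ∑ j, γ j < n) : DiffRep Ω A K n (fun ψ x => c x * Dpow γ ψ x) := by
  classical
  refine ⟨fun δ x => if δ = γ then c x else 0, fun δ => ?_, fun ψ _ x _ => ?_⟩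
  · by_cases h : δ = γ
    · simpa [h] using ⟨hc, hcK⟩
    · simpa [h] using Sm.const 0
  · simp [ite_mul, mem_MI, hγ]

/-- multiplication by a smooth function (vanishing off `L`). -/
theorem DiffRep.smul {n : ℕ} {T : (Euc d → ℂ) → Euc d → ℂ} (h : DiffRep Ω A K n T) {L : Set (Euc d)}
    {c : Euc d → ℂ} (hc : Sm Ω c) (hcL : ∀ x ∉ L, c x = 0) :
    DiffRep Ω A (K ∩ L) n (fun ψ x => c x * T ψ x) := by
  obtain ⟨b, hb, h⟩ := h
  refine ⟨fun γ x => c x * b γ x, fun γ => ⟨hc.mul' (hb γ).1, fun x hx => ?_⟩, ?_⟩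
  · by_cases h1 : x ∈ K
    · simp [hcL x fun h2 => hx ⟨h1, h2⟩]
    · simp [(hb γ).2 x h1]
  · intro ψ hψ x hx
    simp only [h ψ hψ x hx, Finset.mul_sum, mul_assoc]

theorem DiffRep.const_smul {n : ℕ} {T : (Euc d → ℂ) → Euc d → ℂ} (h : DiffRep Ω A K n T) (a : ℂ) :
    DiffRep Ω A K n (fun ψ x => a * T ψ x) := by
  simpa using h.smul (L := Set.univ) (Sm.const (Ω := Ω) a) (by simp)

theorem DiffRep.mono {n n' : ℕ} (hn : n ≤ n') {T : (Euc d → ℂ) → Euc d → ℂ} (h : DiffRep Ω A K n T) :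
    DiffRep Ω A K n' T := by
  obtain ⟨c, hc, h⟩ := h
  refine DiffRep.congr' (DiffRep.sum (MI d n) (T := fun γ ψ x => c γ x * Dpow γ ψ x) fun γ hγ => ?_) h
  exact DiffRep.mono_single (hc γ).1 (hc γ).2 γ (lt_of_lt_of_le (mem_MI.1 hγ) hn)

theorem DiffRep.smooth (hΩ : IsOpen Ω) {n : ℕ} {T : (Euc d → ℂ) → Euc d → ℂ} (h : DiffRep Ω A K n T)
    {ψ : Euc d → ℂ} (hψ : Sm Ω ψ) (hA : ψ ∈ A) : Sm Ω (T ψ) := by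
  obtain ⟨c, hc, h⟩ := h
  exact Sm.congr' (Sm.sum' fun γ _ => (hc γ).1.mul' (Dpow_smooth hΩ γ hψ)) (h ψ hA)

theorem pd_sum (hΩ : IsOpen Ω) (j : Fin d) {ι : Type*} (s : Finset ι)
    {f : ι → Euc d → ℂ} (hf : ∀ i ∈ s, Sm Ω (f i)) :
    ∀ x ∈ Ω, pd j (fun y => ∑ i ∈ s, f i y) x = ∑ i ∈ s, pd j (f i) x := by
  intro x hx
  simp only [pd]
  rw [fderiv_fun_sum fun i hi => (hf i hi).diff hΩ hx]
  simp

theorem DiffRep.pd' (hΩ : IsOpen Ω) (hK : IsClosed K) (hA : ∀ ψ ∈ A, Sm Ω ψ) (j : Fin d) {n : ℕ}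
    {T : (Euc d → ℂ) → Euc d → ℂ} (h : DiffRep Ω A K n T) :
    DiffRep Ω A K (n + 1) (fun ψ => pd j (T ψ)) := by
  obtain ⟨c, hc, h⟩ := h
  refine DiffRep.congr' (DiffRep.sum (MI d n) (T := fun γ ψ x => pd j (c γ) x * Dpow γ ψ x +
    Complex.I * (c γ x * Dpow (γ + Pi.single j 1) ψ x)) fun γ hγ => DiffRep.add ?_ ?_) ?_
  · have := mem_MI.1 hγ
    exact DiffRep.mono_single (pd_smooth hΩ j (hc γ).1) (pd_zero_off hK j (hc γ).2) γ (by omega)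
  · have := mem_MI.1 hγ
    exact DiffRep.const_smul (DiffRep.mono_single (hc γ).1 (hc γ).2 _ (by rw [sum_succ]; omega)) _
  · intro ψ hψ x hx
    rw [pd_congr hΩ j (h ψ hψ) x hx,
      pd_sum hΩ j _ (fun γ _ => (hc γ).1.mul' (Dpow_smooth hΩ γ (hA ψ hψ))) x hx]
    refine Finset.sum_congr rfl fun γ _ => ?_
    rw [pd_mul hΩ j (hc γ).1 (Dpow_smooth hΩ γ (hA ψ hψ)) x hx, Dpow_succ hΩ γ j (hA ψ hψ) x hx]
    linear_combination (c γ x * pd j (Dpow γ ψ) x) * Complex.I_mul_I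

/-- commutator of `D^β` with multiplication by `h`. -/
theorem comm_Dpow (hΩ : IsOpen Ω) (hK : IsClosed K) {h : Euc d → ℂ} (hh : Sm Ω h)
    (hhK : ∀ x ∉ K, h x = 0) (β : Fin d → ℕ) :
    DiffRep Ω {ψ | Sm Ω ψ} K (∑ j, β j)
      (fun g x => Dpow β (fun y => h y * g y) x - h x * Dpow β g x) := by
  induction β using ind_multi with
  | h0 => simpa [Dpow_zero] using DiffRep.zero
  | hs β j ih =>
    rw [sum_succ]
    have h1 := (ih.pd' hΩ hK (fun _ h => h) j).add
      (DiffRep.mono_single (pd_smooth hΩ j hh) (pd_zero_off hK j hhK) β (Nat.lt_succ_self _))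
    refine (h1.const_smul (-Complex.I)).congr' ?_
    intro g hg x hx
    have hhg : Sm Ω (fun y => h y * g y) := hh.mul' hg
    have hR := ih.smooth hΩ hg hg
    have e : ∀ y ∈ Ω, Dpow β (fun y => h y * g y) y =
        (Dpow β (fun y => h y * g y) y - h y * Dpow β g y) + h y * Dpow β g y := by
      intro y _; ring
    rw [Dpow_succ hΩ β j hhg x hx, Dpow_succ hΩ β j hg x hx, pd_congr hΩ j e x hx,
      pd_add hΩ j hR (hh.mul' (Dpow_smooth hΩ β hg)) x hx,
      pd_mul hΩ j hh (Dpow_smooth hΩ β hg) x hx]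
    ring

theorem comm_toOp (hΩ : IsOpen Ω) (hK : IsClosed K) {h : Euc d → ℂ} (hh : Sm Ω h)
    (hhK : ∀ x ∉ K, h x = 0) (P : MvPolynomial (Fin d) ℂ) {m : ℕ} (hdeg : P.totalDegree ≤ m) :
    DiffRep Ω {ψ | Sm Ω ψ} K m
      (fun g x => toOp P (fun y => h y * g y) x - h x * toOp P g x) := by
  refine DiffRep.congr' (DiffRep.sum P.support (T := fun β g x => P.coeff β *
    (Dpow (fun j => β j) (fun y => h y * g y) x - h x * Dpow (fun j => β j) g x))
    fun β hβ => ?_) ?_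
  · refine ((comm_Dpow hΩ hK hh hhK (fun j => β j)).const_smul _).mono ?_
    have := MvPolynomial.le_totalDegree hβ
    rw [Finsupp.sum_fintype _ _ (by simp)] at this
    exact this.trans hdeg
  · intro g _ x _
    simp only [toOp, Finset.mul_sum, ← Finset.sum_sub_distrib]
    exact Finset.sum_congr rfl fun β _ => by ring

theorem DiffRep.comp_Dpow (hΩ : IsOpen Ω) (hA : ∀ ψ ∈ A, Sm Ω ψ) {n : ℕ}
    {T : (Euc d → ℂ) → Euc d → ℂ} (h : DiffRep Ω {ψ | Sm Ω ψ} K n T) (γ : Fin d → ℕ) :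
    DiffRep Ω A K (n + ∑ j, γ j) (fun ψ => T (Dpow γ ψ)) := by
  obtain ⟨c, hc, h⟩ := h
  refine DiffRep.congr' (DiffRep.sum (MI d n) (T := fun δ ψ x => c δ x * Dpow (δ + γ) ψ x)
    fun δ hδ => ?_) ?_
  · refine DiffRep.mono_single (hc δ).1 (hc δ).2 _ ?_
    have := mem_MI.1 hδ
    simp only [Pi.add_apply, Finset.sum_add_distrib]
    omega
  · intro ψ hψ x hx
    rw [h _ (Dpow_smooth hΩ γ (hA ψ hψ)) x hx]
    exact Finset.sum_congr rfl fun δ _ => by rw [Dpow_Dpow hΩ _ _ (hA ψ hψ) x hx]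

theorem DiffRep.step (hΩ : IsOpen Ω) (hK : IsClosed K) {P : MvPolynomial (Fin d) ℂ} {m : ℕ}
    (hm : 1 ≤ m) (hdeg : P.totalDegree ≤ m) {V : Euc d → ℂ} (hV : Sm Ω V) {lam : ℂ}
    (hA : ∀ ψ ∈ A, Sm Ω ψ)
    (hsol : ∀ ψ ∈ A, ∀ y ∈ Ω, toOp P ψ y + V y * ψ y = lam * ψ y) {n : ℕ}
    {T : (Euc d → ℂ) → Euc d → ℂ} (h : DiffRep Ω A K (n + 1) T) :
    DiffRep Ω A K (n + (m - 1) + 1) (fun ψ y => toOp P (T ψ) y - lam * T ψ y) := by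
  have hT := h
  obtain ⟨c, hc, h⟩ := h
  refine DiffRep.congr' (DiffRep.sum (MI d (n + 1)) (T := fun γ ψ x =>
    (toOp P (fun y => c γ y * Dpow γ ψ y) x - c γ x * toOp P (Dpow γ ψ) x)
    + (-1) * (c γ x * ((Dpow γ (fun y => V y * ψ y) x - V x * Dpow γ ψ x)
      + V x * Dpow γ ψ x))) fun γ hγ => ?_) ?_
  · have hγ' := mem_MI.1 hγ
    refine DiffRep.add ?_ (DiffRep.const_smul ?_ _)
    · exact ((comm_toOp hΩ hK (hc γ).1 (hc γ).2 P hdeg).comp_Dpow hΩ hA γ).mono (by omega)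
    · have h1 : DiffRep Ω A Set.univ (n + (m - 1) + 1)
          (fun ψ x => Dpow γ (fun y => V y * ψ y) x - V x * Dpow γ ψ x) := by
        obtain ⟨b, hb, h'⟩ := (comm_Dpow hΩ isClosed_univ hV (by simp) γ).mono
          (show _ ≤ n + (m - 1) + 1 by omega)
        exact ⟨b, hb, fun ψ hψ => h' ψ (hA ψ hψ)⟩
      have h2 : DiffRep Ω A Set.univ (n + (m - 1) + 1) (fun ψ x => V x * Dpow γ ψ x) :=
        DiffRep.mono_single hV (by simp) γ (by omega)
      simpa using (h1.add h2).smul (hc γ).1 (hc γ).2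
  · intro ψ hψ x hx
    have hs := hA ψ hψ
    have hterm : ∀ γ ∈ MI d (n + 1), Sm Ω (fun y => c γ y * Dpow γ ψ y) :=
      fun γ _ => (hc γ).1.mul' (Dpow_smooth hΩ γ hs)
    rw [toOp_congr hΩ P (hT.smooth hΩ hs hψ) (Sm.sum' hterm) (h ψ hψ) x hx,
      toOp_sum hΩ P _ hterm x hx, h ψ hψ x hx, Finset.mul_sum, ← Finset.sum_sub_distrib]
    refine Finset.sum_congr rfl fun γ _ => ?_
    have e : toOp P (Dpow γ ψ) x + Dpow γ (fun y => V y * ψ y) x = lam * Dpow γ ψ x := by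
      rw [toOp_Dpow hΩ P γ hs x hx, ← Dpow_add hΩ γ (toOp_smooth hΩ P hs) (hV.mul' hs) x hx,
        ← Dpow_const_mul hΩ γ lam hs x hx]
      exact Dpow_congr hΩ γ ((toOp_smooth hΩ P hs).add' (hV.mul' hs)) ((Sm.const lam).mul' hs)
        (hsol ψ hψ) x hx
    linear_combination c γ x * e

end helpers

/-- for an `m`-th order constant coefficient operator `H` (`m ≥ 1`),
a smooth solution `ψ_λ` of `(H+V)ψ_λ = λψ_λ` on `Ω` and a cutoff `χ ∈ C_c^∞` supported in
`B(x₀,r) ⊆ Ω`, for every integer `α ≥ 1` there is a finite family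
`(h_γ)_{|γ| ≤ α(m−1)}` of smooth functions supported in `B(x₀,r)` (independent of `ψ_λ`)
with `(H−λ)^α(χψ_λ) = Σ_{|γ|≤α(m−1)} h_γ D^γ ψ_λ` on `Ω`. -/
theorem statement18
    (d m : ℕ) (hm : 1 ≤ m) (Ω : Set (Euc d)) (hΩ : IsOpen Ω) (hne : Ω.Nonempty)
    (P : MvPolynomial (Fin d) ℂ) (hdeg : P.totalDegree ≤ m)
    (V : Euc d → ℂ) (hV : ContDiffOn ℝ (⊤ : ℕ∞) V Ω) (lam : ℂ)
    (x₀ : Euc d) (r : ℝ) (hball : ball x₀ r ⊆ Ω)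
    (χ : Euc d → ℂ) (hχ : ContDiff ℝ (⊤ : ℕ∞) χ) (hχc : HasCompactSupport χ)
    (hχsupp : tsupport χ ⊆ ball x₀ r)
    (α : ℕ) (hα : 1 ≤ α) :
    ∃ S : Finset (Fin d → ℕ), (∀ γ ∈ S, ∑ j, γ j ≤ α * (m - 1)) ∧
    ∃ hfam : (Fin d → ℕ) → Euc d → ℂ,
      (∀ γ ∈ S, ContDiffOn ℝ (⊤ : ℕ∞) (hfam γ) Ω ∧ ∀ x ∉ ball x₀ r, hfam γ x = 0) ∧
      ∀ ψ : Euc d → ℂ, ContDiffOn ℝ (⊤ : ℕ∞) ψ Ω →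
      (∀ y ∈ Ω, toOp P ψ y + V y * ψ y = lam * ψ y) →
      ∀ x ∈ Ω,
      ((fun f : Euc d → ℂ => fun y => toOp P f y - lam * f y)^[α]
          (fun y => χ y * ψ y)) x
        = ∑ γ ∈ S, hfam γ x * Dpow γ ψ x := by
  classical
  let A : Set (Euc d → ℂ) :=
    {ψ | Sm Ω ψ ∧ ∀ y ∈ Ω, toOp P ψ y + V y * ψ y = lam * ψ y}
  have key : ∀ a : ℕ, DiffRep Ω A (tsupport χ) (a * (m - 1) + 1)
      (fun ψ => (fun f : Euc d → ℂ => fun y => toOp P f y - lam * f y)^[a]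
        (fun y => χ y * ψ y)) := by
    intro a
    induction a with
    | zero =>
      have := DiffRep.mono_single (A := A) (K := tsupport χ) (n := 0 * (m - 1) + 1)
        (hχ.contDiffOn (s := Ω)) (fun x hx => image_eq_zero_of_notMem_tsupport hx) 0 (by simp)
      simpa [Dpow_zero] using this
    | succ a ih =>
      have := ih.step hΩ (isClosed_tsupport χ) hm hdeg hV (fun ψ h => h.1) (fun ψ h => h.2)
      simp only [Function.iterate_succ_apply']
      rw [Nat.succ_mul]
      exact this
  obtain ⟨c, hc, h⟩ := key α
  refine ⟨MI d (α * (m - 1) + 1), fun γ hγ => Nat.lt_succ_iff.1 (mem_MI.1 hγ), c,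
    fun γ _ => ⟨(hc γ).1, fun x hx => (hc γ).2 x fun hx' => hx (hχsupp hx')⟩, ?_⟩
  intro ψ hψ hsol x hx
  exact h ψ ⟨hψ, hsol⟩ x hx

end
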